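/- arXiv:0804.4694 — 4 statements merged into one kernel-verified Lean document; each statement's English description precedes it below -/
import Mathlib

section
/- Let k, m, d, r be integers with d ≥ 0 and r ≥ 0. If the identity t^{3k} + (−1)^m t^{3k+m} = t^d + t^r holds in ℤ[t,t⁻¹], then k ≥ 0, and if k = 0 then m ≥ 0. (By the Honda–Kazez–Matić criterion this is exactly the condition for the reducible braid Δ^{2k} τ σ₁^m τ⁻¹ to be right-veering.) -/
open LaurentPolynomial

/-- If the trace t^{3k} + (−1)^m t^{3k+m} of the reduced Burau matrix of a reducible
3-braid Δ^{2k} τ σ₁^m τ⁻¹ equals t^d + t^r with d, r nonnegative, then k ≥ 0 and,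
if k = 0, also m ≥ 0; i.e. the braid is right-veering by the Honda–Kazez–Matić
criterion. -/
theorem right_veering_of_trace_nonneg_exponents (k m d r : ℤ) (hd : 0 ≤ d) (hr : 0 ≤ r)
    (h : (T (3 * k) : LaurentPolynomial ℤ) +
        (((-1 : (LaurentPolynomial ℤ)ˣ) ^ m : (LaurentPolynomial ℤ)ˣ) : LaurentPolynomial ℤ)
          * T (3 * k + m) =
      T d + T r) :
    0 ≤ k ∧ (k = 0 → 0 ≤ m) := by
  have coeff_eq (n : ℤ) := congrArg (fun p : LaurentPolynomial ℤ => p.coeff n) h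
  have h₀ := coeff_eq (3 * k)
  have h₁ := coeff_eq (3 * k + m)
  rcases Int.even_or_odd m with hm | hm
  · simp only [hm.neg_one_zpow, Units.val_one, one_mul, AddMonoidAlgebra.coeff_add,
      Finsupp.add_apply, T_apply] at h₀ h₁
    grind
  · have neg_one_zpow : (-1 : (LaurentPolynomial ℤ)ˣ) ^ m = -1 := by
      obtain ⟨a, rfl⟩ := hm
      rw [zpow_add, (even_two_mul a).neg_one_zpow, one_mul, zpow_one]
    simp only [neg_one_zpow, Units.val_neg, Units.val_one, neg_mul, one_mul,
      AddMonoidAlgebra.coeff_add, AddMonoidAlgebra.coeff_neg, Finsupp.add_apply,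
      Finsupp.neg_apply, T_apply] at h₀ h₁
    grind
end

section
/- Every element of SL(2,ℤ) of trace −2 is the negative of a conjugate of a power of the standard unipotent matrix: if M ∈ SL(2,ℤ) and tr M = −2, then there exist T ∈ SL(2,ℤ) and m ∈ ℤ such that M = T * [[−1, −m], [0, −1]] * T⁻¹. -/
open Matrix

/-- An integer 2×2 matrix of determinant one and trace `-2` has a primitive eigenvector `(p, q)`
for the eigenvalue `-1`. -/
theorem exists_isCoprime_eigenvector_neg_one {a b c d : ℤ} (hdet : a * d - b * c = 1)
    (htr : a + d = -2) :
    ∃ p q : ℤ, IsCoprime p q ∧ a * p + b * q = -p ∧ c * p + d * q = -q := by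
  obtain rfl : a = -2 - d := by linarith
  by_cases hc : c = 0
  · subst hc
    refine ⟨1, 0, isCoprime_one_left, ?_, by ring⟩
    have hd : (d + 1) ^ 2 = 0 := by linear_combination -hdet
    have hd' : d + 1 = 0 := by simpa using hd
    linear_combination -hd'
  · have hg : 0 < Int.gcd (d + 1) c := Int.gcd_pos_of_ne_zero_right _ hc
    obtain ⟨p, q, hcop, hp, hq⟩ := Int.exists_gcd_one hg
    have hg0 : (Int.gcd (d + 1) c : ℤ) ≠ 0 := by exact_mod_cast hg.ne'
    refine ⟨p, -q, (Int.isCoprime_iff_gcd_eq_one.mpr hcop).neg_right, ?_, ?_⟩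
    · apply mul_right_cancel₀ hg0
      linear_combination (d + 1) * hp + b * hq + hdet
    · apply mul_right_cancel₀ hg0
      linear_combination -c * hp + (d + 1) * hq

/-- Every element of SL(2,ℤ) of trace −2 is the negative of a conjugate of a power of
the standard unipotent matrix, i.e. equals T·[[−1,−m],[0,−1]]·T⁻¹ for some T, m. -/
theorem trace_neg_two_conj_neg_unipotent (M : Matrix.SpecialLinearGroup (Fin 2) ℤ)
    (h : Matrix.trace (M : Matrix (Fin 2) (Fin 2) ℤ) = -2) :
    ∃ (T : Matrix.SpecialLinearGroup (Fin 2) ℤ) (m : ℤ),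
      M = T * ⟨!![-1, -m; 0, -1], by norm_num [Matrix.det_fin_two_of]⟩ * T⁻¹ := by
  have hdet := M.det_coe
  rw [det_fin_two] at hdet
  rw [trace_fin_two] at h
  obtain ⟨p, q, hpq, h₀, h₁⟩ := exists_isCoprime_eigenvector_neg_one hdet h
  obtain ⟨T, rfl, rfl⟩ := hpq.exists_SL2_col 0
  have hT := T.det_coe
  rw [det_fin_two] at hT
  refine ⟨T, -(T⁻¹ * M * T).val 0 1, ?_⟩
  rw [eq_mul_inv_iff_mul_eq]
  refine inv_mul_eq_iff_eq_mul.mp ?_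
  rw [← mul_assoc]
  ext i j
  fin_cases i <;> fin_cases j <;>
    simp [adjugate_fin_two, mul_apply, vecMul, dotProduct, Fin.sum_univ_two]
  · linear_combination T 1 1 * h₀ - T 0 1 * h₁ - hT
  · linear_combination T 0 0 * h₁ - T 1 0 * h₀
  · linear_combination -T 1 1 * h₀ + T 0 1 * h₁ + (M 0 0 + M 1 1 + 1) * hT + h
end

section
/- The Burau representation of the 3-strand braid group is faithful: the group homomorphism from the braid group B₃, presented as the group generated by x, y subject to the single relation x y x = y x y, into the group of invertible 2×2 matrices over ℤ[t,t⁻¹] determined by x ↦ A and y ↦ B, is injective. -/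
open LaurentPolynomial Matrix

/-- The reduced Burau matrix of σ₁ ∈ B₃. -/
noncomputable def Amat : Matrix (Fin 2) (Fin 2) (LaurentPolynomial ℤ) := !![-T 1, 1; 0, 1]

/-- The reduced Burau matrix of σ₂ ∈ B₃. -/
noncomputable def Bmat : Matrix (Fin 2) (Fin 2) (LaurentPolynomial ℤ) := !![1, 0; T 1, -T 1]

/-- The reduced Burau matrix of σ₁, as an invertible matrix. -/
noncomputable def Au : (Matrix (Fin 2) (Fin 2) (LaurentPolynomial ℤ))ˣ where
  val := Amat
  inv := !![-T (-1), T (-1); 0, 1]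
  val_inv := by
    simp only [Amat, Matrix.mul_fin_two, Matrix.one_fin_two, neg_mul_neg, neg_mul, mul_neg,
      ← T_add]
    norm_num
  inv_val := by
    simp only [Amat, Matrix.mul_fin_two, Matrix.one_fin_two, neg_mul_neg, neg_mul, mul_neg,
      ← T_add]
    norm_num

/-- The reduced Burau matrix of σ₂, as an invertible matrix. -/
noncomputable def Bu : (Matrix (Fin 2) (Fin 2) (LaurentPolynomial ℤ))ˣ where
  val := Bmat
  inv := !![1, 0; 1, -T (-1)]
  val_inv := by
    simp only [Bmat, Matrix.mul_fin_two, Matrix.one_fin_two, neg_mul_neg, neg_mul, mul_neg,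
      ← T_add]
    norm_num
  inv_val := by
    simp only [Bmat, Matrix.mul_fin_two, Matrix.one_fin_two, neg_mul_neg, neg_mul, mul_neg,
      ← T_add]
    norm_num

/-- The braid relation of B₃ = ⟨x, y | xyx = yxy⟩, as a set of relators in the
free group on two generators: x ↦ 0, y ↦ 1. -/
def braidRels : Set (FreeGroup (Fin 2)) :=
  {FreeGroup.of 0 * FreeGroup.of 1 * FreeGroup.of 0 *
    (FreeGroup.of 1 * FreeGroup.of 0 * FreeGroup.of 1)⁻¹}

section TorusKnotNormalForm

variable {G : Type*} [Group G]

/-- The elements `(b³)^k b^i m a^j` with `i ≤ 2`, `j ≤ 1` and `m` in the submonoid generated by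
`a⁻¹b` and `ab⁻¹`. When `a² = b³` and `a`, `b` generate the group, these are all its elements. -/
def IsTorusKnotNormalForm (a b g : G) : Prop :=
  ∃ (k : ℤ) (i j : ℕ) (m : G), i ≤ 2 ∧ j ≤ 1 ∧
    m ∈ Submonoid.closure {a⁻¹ * b, a * b⁻¹} ∧ g = (b ^ 3) ^ k * (b ^ i * m * a ^ j)

theorem IsTorusKnotNormalForm.zpow_mul {a b g : G} (hg : IsTorusKnotNormalForm a b g) (n : ℤ) :
    IsTorusKnotNormalForm a b ((b ^ 3) ^ n * g) := by
  obtain ⟨k, i, j, m, hi, hj, hm, rfl⟩ := hg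
  exact ⟨n + k, i, j, m, hi, hj, hm, by rw [_root_.zpow_add, mul_assoc ((b ^ 3) ^ n)]⟩

theorem IsTorusKnotNormalForm.right_mul {a b g : G} (hg : IsTorusKnotNormalForm a b g) :
    IsTorusKnotNormalForm a b (b * g) := by
  obtain ⟨k, i, j, m, hi, hj, hm, rfl⟩ := hg
  have hc : b * ((b ^ 3) ^ k * (b ^ i * m * a ^ j)) = (b ^ 3) ^ k * (b ^ (i + 1) * m * a ^ j) := by
    rw [← mul_assoc, (((Commute.refl b).pow_right 3).zpow_right k).eq, pow_succ' b i]
    simp only [mul_assoc]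
  rw [hc]
  apply IsTorusKnotNormalForm.zpow_mul
  rcases hi.lt_or_eq with hi | rfl
  · exact ⟨0, i + 1, j, m, hi, hj, hm, by simp⟩
  · exact ⟨1, 0, j, m, by simp, hj, hm, by simp [mul_assoc]⟩

theorem IsTorusKnotNormalForm.left_mul {a b g : G} (h : a ^ 2 = b ^ 3)
    (hg : IsTorusKnotNormalForm a b g) : IsTorusKnotNormalForm a b (a * g) := by
  obtain ⟨k, i, j, m, hi, hj, hm, rfl⟩ := hg
  have hac : Commute a (b ^ 3) := h ▸ (Commute.refl a).pow_right 2
  have hc : a * ((b ^ 3) ^ k * (b ^ i * m * a ^ j)) =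
      (b ^ 3) ^ k * (a * (b ^ i * m * a ^ j)) := by
    rw [← mul_assoc, (hac.zpow_right k).eq, mul_assoc]
  rw [hc]
  apply IsTorusKnotNormalForm.zpow_mul
  interval_cases i
  · induction hm using Submonoid.closure_induction_left with
    | one =>
      interval_cases j
      · exact ⟨0, 0, 1, 1, by simp, le_rfl, one_mem _, by simp⟩
      · exact ⟨1, 0, 0, 1, by simp, by simp, one_mem _, by simp [← h, pow_two]⟩
    | mul_left u hu m hm _ =>
      rcases hu with rfl | rfl
      · exact ⟨0, 1, j, m, by simp, hj, hm, by simp [mul_assoc]⟩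
      · refine ⟨0, 2, j, m, le_rfl, hj, hm, ?_⟩
        have : a * (a * b⁻¹) = b ^ 2 := by rw [← mul_assoc, ← pow_two, h]; group
        simp only [← this]
        simp [mul_assoc]
  · refine ⟨1, 0, j, a⁻¹ * b * m, by simp, hj,
      mul_mem (Submonoid.subset_closure (by simp)) hm, ?_⟩
    simp [← h, pow_two, mul_assoc]
  · refine ⟨1, 0, j, a * b⁻¹ * m, by simp, hj,
      mul_mem (Submonoid.subset_closure (by simp)) hm, ?_⟩
    have : b ^ 3 * (a * b⁻¹) = a * b ^ 2 := by rw [← mul_assoc, ← hac.eq]; group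
    simp only [pow_zero, one_mul, zpow_one, ← mul_assoc] at this ⊢
    rw [this]

theorem isTorusKnotNormalForm_of_mem_closure {a b : G} (h : a ^ 2 = b ^ 3) {g : G}
    (hg : g ∈ Subgroup.closure {a, b}) : IsTorusKnotNormalForm a b g := by
  induction hg using Subgroup.closure_induction_left with
  | one => exact ⟨0, 0, 0, 1, by simp, by simp, one_mem _, by simp⟩
  | mul_left u hu g _ ih =>
    rcases hu with rfl | rfl
    exacts [ih.left_mul h, ih.right_mul]
  | inv_mul_cancel u hu g _ ih =>
    rcases hu with rfl | rfl
    · have : u⁻¹ * g = (b ^ 3) ^ (-1 : ℤ) * (u * g) := by simp [← h, pow_two, mul_assoc]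
      rw [this]
      exact (ih.left_mul h).zpow_mul _
    · have : u⁻¹ * g = (u ^ 3) ^ (-1 : ℤ) * (u * (u * g)) := by simp [pow_succ, mul_assoc]
      rw [this]
      exact ih.right_mul.right_mul.zpow_mul _

end TorusKnotNormalForm

section SpecializationAtNegOne

variable {G : Type*} [Group G]

/-- The submonoid generated by `x⁻¹` and `y` maps to matrices with nonnegative diagonal and
nonpositive off-diagonal entries, and only `1` has a diagonal image. -/
theorem exists_entries_of_mem_closure (σ : G →* Matrix (Fin 2) (Fin 2) ℤ) {u v : G}
    (hu : σ u = !![1, -1; 0, 1]) (hv : σ v = !![1, 0; -1, 1])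
    {m : G} (hm : m ∈ Submonoid.closure {u, v}) :
    ∃ p q r s : ℤ, σ m = !![p, -q; -r, s] ∧ 1 ≤ p ∧ 0 ≤ q ∧ 0 ≤ r ∧ 1 ≤ s ∧
      (m = 1 ∨ 1 ≤ q + r) := by
  induction hm using Submonoid.closure_induction_left with
  | one => exact ⟨1, 0, 0, 1, by simp [Matrix.one_fin_two], by simp⟩
  | mul_left w hw m _ ih =>
    obtain ⟨p, q, r, s, hσ, hp, hq, hr, hs, -⟩ := ih
    rcases hw with rfl | rfl
    · refine ⟨p + r, q + s, r, s, ?_, by omega, by omega, by omega, by omega, by omega⟩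
      rw [map_mul, hu, hσ, Matrix.mul_fin_two]
      ext i j; fin_cases i <;> fin_cases j <;> simp; ring
    · refine ⟨p, q, p + r, q + s, ?_, by omega, by omega, by omega, by omega, by omega⟩
      rw [map_mul, hv, hσ, Matrix.mul_fin_two]
      ext i j; fin_cases i <;> fin_cases j <;> simp; ring

/-- In a group generated by `x`, `y` with `xyx = yxy`, a homomorphism extending the Burau matrices
at `t = -1` has kernel contained in the cyclic subgroup generated by `(xy)³`. -/
theorem exists_eq_zpow_of_map_eq_one {x y : G} (h : x * y * x = y * x * y)
    (htop : Subgroup.closure {x, y} = ⊤) (σ : G →* Matrix (Fin 2) (Fin 2) ℤ)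
    (hx : σ x = !![1, 1; 0, 1]) (hx' : σ x⁻¹ = !![1, -1; 0, 1]) (hy : σ y = !![1, 0; -1, 1])
    {g : G} (hg : σ g = 1) : ∃ k : ℤ, g = ((x * y) ^ 3) ^ k := by
  have hab : (x * y * x) ^ 2 = (x * y) ^ 3 := by
    rw [pow_two]
    nth_rw 2 [h]
    simp [pow_succ, mul_assoc]
  have hu : (x * y * x)⁻¹ * (x * y) = x⁻¹ := by group
  have hv : x * y * x * (x * y)⁻¹ = y := by rw [h]; group
  have hmem : g ∈ Subgroup.closure {x * y * x, x * y} := by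
    have ha : x * y * x ∈ Subgroup.closure {x * y * x, x * y} := Subgroup.subset_closure (by simp)
    have hb : x * y ∈ Subgroup.closure {x * y * x, x * y} := Subgroup.subset_closure (by simp)
    have hle : Subgroup.closure {x, y} ≤ Subgroup.closure {x * y * x, x * y} := by
      rw [Subgroup.closure_le]
      rintro z (rfl | rfl)
      · have := mul_mem (inv_mem ha) hb
        rw [hu] at this
        exact inv_mem_iff.1 this
      · have := mul_mem ha (inv_mem hb)
        rwa [hv] at this
    exact hle (htop ▸ Subgroup.mem_top g)
  obtain ⟨k, i, j, m, hi, hj, hm, rfl⟩ := isTorusKnotNormalForm_of_mem_closure hab hmem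
  rw [hu, hv] at hm
  obtain ⟨p, q, r, s, hσ, hp, hq, hr, hs, hm1⟩ := exists_entries_of_mem_closure σ hx' hy hm
  have hb : σ (x * y) = !![0, 1; -1, 1] := by simp [hx, hy]
  have ha : σ (x * y * x) = !![0, 1; -1, 0] := by rw [map_mul, hb, hx]; simp
  have hc : σ ((x * y) ^ 3) = -1 := by
    rw [map_pow, hb]; simp [pow_succ, Matrix.one_fin_two]
  have hck : σ (((x * y) ^ 3) ^ k) = 1 ∨ σ (((x * y) ^ 3) ^ k) = -1 := by
    have hker (n : ℤ) : σ (((x * y) ^ 3) ^ (2 * n)) = 1 := by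
      have h2 : ((x * y) ^ 3) ^ (2 : ℤ) ∈ σ.ker := by
        rw [MonoidHom.mem_ker, zpow_ofNat, map_pow, hc]; simp
      rw [_root_.zpow_mul]
      exact zpow_mem h2 n
    obtain ⟨n, rfl | rfl⟩ := Int.even_or_odd' k
    · exact .inl (hker n)
    · right; rw [_root_.zpow_add, map_mul, hker, zpow_one, hc, one_mul]
  refine ⟨k, ?_⟩
  have hprod : σ (x * y) ^ i * σ m * σ (x * y * x) ^ j = 1 ∨
      σ (x * y) ^ i * σ m * σ (x * y * x) ^ j = -1 := by
    rw [map_mul, map_mul, map_mul, map_pow, map_pow] at hg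
    rcases hck with hck | hck <;> rw [hck] at hg
    · left; simpa using hg
    · right; simpa [neg_eq_iff_eq_neg] using hg
  rw [hb, ha, hσ] at hprod
  have hij : i = 0 ∧ j = 0 ∧ q + r = 0 := by
    interval_cases i <;> interval_cases j <;>
      simp [pow_succ, Matrix.one_fin_two] at hprod <;> omega
  obtain ⟨rfl, rfl, hqr⟩ := hij
  simp [hm1.resolve_right (by omega)]

end SpecializationAtNegOne

/-- Evaluation at a unit of an integral Laurent polynomial matrix. -/
noncomputable def evalMatrixHom {S : Type*} [CommRing S] (t : Sˣ) :
    (Matrix (Fin 2) (Fin 2) (LaurentPolynomial ℤ))ˣ →* Matrix (Fin 2) (Fin 2) S :=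
  (((eval₂ (Int.castRingHom S) t).mapMatrix (m := Fin 2)).toMonoidHom).comp (Units.coeHom _)

theorem Au_mul_Bu_mul_Au : Au * Bu * Au = Bu * Au * Bu := by
  apply Units.ext
  simp only [Units.val_mul, Au, Bu, Amat, Bmat, Matrix.mul_fin_two]
  ext i j; fin_cases i <;> fin_cases j <;> simp

theorem evalMatrixHom_Au {S : Type*} [CommRing S] (t : Sˣ) :
    evalMatrixHom t Au = !![-(t : S), 1; 0, 1] := by
  ext i j; fin_cases i <;> fin_cases j <;> simp [evalMatrixHom, Au, Amat]

theorem evalMatrixHom_Au_inv {S : Type*} [CommRing S] (t : Sˣ) :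
    evalMatrixHom t Au⁻¹ = !![-((t⁻¹ : Sˣ) : S), ((t⁻¹ : Sˣ) : S); 0, 1] := by
  ext i j; fin_cases i <;> fin_cases j <;> simp [evalMatrixHom, Au]

theorem evalMatrixHom_Bu {S : Type*} [CommRing S] (t : Sˣ) :
    evalMatrixHom t Bu = !![1, 0; (t : S), -(t : S)] := by
  ext i j; fin_cases i <;> fin_cases j <;> simp [evalMatrixHom, Bu, Bmat]

/-- The image of the full twist has infinite order, as seen from its determinant. -/
theorem eq_zero_of_Au_mul_Bu_pow_three_zpow_eq_one {k : ℤ} (h : ((Au * Bu) ^ 3) ^ k = 1) :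
    k = 0 := by
  let t : ℚˣ := Units.mk0 2 two_ne_zero
  let δ := (Matrix.detMonoidHom (n := Fin 2) (R := ℚ)).comp (evalMatrixHom t)
  have hc : δ ((Au * Bu) ^ 3) = 64 := by
    have hab : δ (Au * Bu) = 4 := by
      simp only [δ, MonoidHom.comp_apply, map_mul, evalMatrixHom_Au, evalMatrixHom_Bu]
      norm_num [t, Matrix.det_fin_two]
    rw [map_pow, hab]
    norm_num
  have hk := congrArg δ h
  rw [map_zpow, hc, map_one] at hk
  exact (zpow_eq_one_iff_right₀ (by norm_num) (by norm_num)).1 hk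

/-- The reduced Burau representation of B₃ is faithful: the homomorphism from
B₃ = ⟨x, y | xyx = yxy⟩ to the invertible 2×2 matrices over ℤ[t,t⁻¹] determined by
x ↦ A, y ↦ B exists and is injective. -/
theorem burau_faithful_for_three_strands :
    ∃ φ : PresentedGroup braidRels →* (Matrix (Fin 2) (Fin 2) (LaurentPolynomial ℤ))ˣ,
      φ (PresentedGroup.of 0) = Au ∧ φ (PresentedGroup.of 1) = Bu ∧
      Function.Injective φ := by
  have hrel : ∀ r ∈ braidRels, FreeGroup.lift ![Au, Bu] r = 1 := by
    rintro r rfl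
    simp only [map_mul, map_inv, FreeGroup.lift_apply_of, mul_inv_eq_one]
    exact Au_mul_Bu_mul_Au
  have hx : PresentedGroup.toGroup hrel (PresentedGroup.of 0) = Au := by simp
  have hy : PresentedGroup.toGroup hrel (PresentedGroup.of 1) = Bu := by simp
  refine ⟨PresentedGroup.toGroup hrel, hx, hy, ?_⟩
  rw [injective_iff_map_eq_one]
  intro g hg
  have hbraid : (PresentedGroup.of 0 * PresentedGroup.of 1 * PresentedGroup.of 0 :
      PresentedGroup braidRels) =
      PresentedGroup.of 1 * PresentedGroup.of 0 * PresentedGroup.of 1 :=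
    mul_inv_eq_one.1 <| PresentedGroup.one_of_mem (rels := braidRels) rfl
  have htop : Subgroup.closure
      {(PresentedGroup.of 0 : PresentedGroup braidRels), PresentedGroup.of 1} = ⊤ := by
    rw [← PresentedGroup.closure_range_of braidRels]
    congr 1
    ext z
    simp [eq_comm]
  obtain ⟨k, rfl⟩ := exists_eq_zpow_of_map_eq_one hbraid htop
    ((evalMatrixHom (-1 : ℤˣ)).comp (PresentedGroup.toGroup hrel))
    (by rw [MonoidHom.comp_apply, hx, evalMatrixHom_Au]; simp)
    (by rw [MonoidHom.comp_apply, map_inv, hx, evalMatrixHom_Au_inv]; simp)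
    (by rw [MonoidHom.comp_apply, hy, evalMatrixHom_Bu]; simp)
    (g := g) (by rw [MonoidHom.comp_apply, hg, map_one])
  rw [map_zpow, map_pow, map_mul, hx, hy] at hg
  rw [eq_zero_of_Au_mul_Bu_pow_three_zpow_eq_one hg, zpow_zero]
end

section
/- Let M be a matrix in the subgroup of invertible 2×2 matrices over ℤ[t,t⁻¹] generated by A and B. If the matrix obtained from M by evaluating each entry at t = −1 is the identity matrix, then there exists an integer k such that M = t^{6k} · I₂. (That is, the kernel of the composite B₃ → SL(2,ℤ) corresponds, under the faithful reduced Burau representation, to the cyclic group generated by the Burau matrix t⁶·I₂ of Δ⁴.) -/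
open LaurentPolynomial Matrix

/-- If `x ^ 2 = y ^ 3`, every element of the group generated by `x` and `y` is a power of `x`,
times a product of copies of `y⁻¹ * x` and `y⁻¹ * y⁻¹ * x`, times a power of `y`. -/
theorem exists_eq_zpow_mul_mul_zpow {G : Type*} [Group G] {x y : G} (h : x ^ 2 = y ^ 3) {g : G}
    (hg : g ∈ Subgroup.closure {x, y}) :
    ∃ m j : ℤ, ∃ P ∈ Submonoid.closure {y⁻¹ * x, y⁻¹ * y⁻¹ * x}, g = x ^ m * P * y ^ j := by
  have hzy : Commute (x ^ 2) y := h ▸ (Commute.refl y).pow_left 3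
  have hx : ∀ g, (∃ m j : ℤ, ∃ P ∈ Submonoid.closure {y⁻¹ * x, y⁻¹ * y⁻¹ * x},
      g = x ^ m * P * y ^ j) → ∀ i : ℤ, ∃ m j : ℤ,
      ∃ P ∈ Submonoid.closure {y⁻¹ * x, y⁻¹ * y⁻¹ * x}, x ^ i * g = x ^ m * P * y ^ j := by
    rintro _ ⟨m, j, P, hP, rfl⟩ i
    exact ⟨i + m, j, P, hP, by simp only [_root_.zpow_add, mul_assoc]⟩
  have hy : ∀ g, (∃ m j : ℤ, ∃ P ∈ Submonoid.closure {y⁻¹ * x, y⁻¹ * y⁻¹ * x},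
      g = x ^ m * P * y ^ j) → ∃ m j : ℤ,
      ∃ P ∈ Submonoid.closure {y⁻¹ * x, y⁻¹ * y⁻¹ * x}, y * g = x ^ m * P * y ^ j := by
    rintro _ ⟨m, j, P, hP, rfl⟩
    have hpow : ∀ n : ℤ, y * x ^ (2 * n) = x ^ (2 * n) * y := fun n => by
      rw [_root_.zpow_mul, zpow_ofNat]
      exact (hzy.zpow_left n).symm.eq
    obtain ⟨n, rfl | rfl⟩ := Int.even_or_odd' m
    · suffices ∃ m j' : ℤ, ∃ Q ∈ Submonoid.closure {y⁻¹ * x, y⁻¹ * y⁻¹ * x},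
          y * (P * y ^ j) = x ^ m * Q * y ^ j' by
        rw [mul_assoc (x ^ _), ← mul_assoc y, hpow, mul_assoc (x ^ _)]
        exact hx _ this _
      induction hP using Submonoid.closure_induction_left with
      | one => exact ⟨0, 1 + j, 1, one_mem _, by simp [_root_.zpow_one_add]⟩
      | mul_left a ha P hP _ =>
        rcases ha with rfl | rfl
        · exact ⟨1, j, P, hP, by simp [mul_assoc]⟩
        · exact ⟨0, j, y⁻¹ * x * P, mul_mem (Submonoid.subset_closure (by simp)) hP,
            by simp [mul_assoc]⟩
    · refine ⟨2 * (n + 1), j, y⁻¹ * y⁻¹ * x * P,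
        mul_mem (Submonoid.subset_closure (by simp)) hP, ?_⟩
      have h2 : y * x = x ^ (2 : ℤ) * (y⁻¹ * y⁻¹ * x) := by
        rw [zpow_ofNat, h]
        group
      rw [mul_add, mul_one, _root_.zpow_add, _root_.zpow_add, zpow_one]
      calc _ = y * x ^ (2 * n) * (x * P * y ^ j) := by group
        _ = x ^ (2 * n) * (y * x) * P * y ^ j := by rw [hpow]; group
        _ = _ := by rw [h2]; group
  induction hg using Subgroup.closure_induction_left with
  | one => exact ⟨0, 0, 1, one_mem _, by simp⟩
  | mul_left a ha g _ ih =>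
    rcases ha with rfl | rfl
    · simpa using hx g ih 1
    · exact hy g ih
  | inv_mul_cancel a ha g _ ih =>
    rcases ha with rfl | rfl
    · simpa using hx g ih (-1)
    · have h3 : a⁻¹ * g = x ^ (-2 : ℤ) * (a * (a * g)) := by
        have : x ^ (-2 : ℤ) = (a ^ 3)⁻¹ := by rw [← h, _root_.zpow_neg, zpow_ofNat]
        rw [this]
        group
      rw [h3]
      exact hx _ (hy _ (hy _ ih)) _

/-- A product of `Au` and `Bu⁻¹` evaluates at `t = -1` to a nonnegative matrix with positive
diagonal, with a nonzero off-diagonal entry unless the product is empty. -/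
theorem eval_entries_of_mem_closure (ev : LaurentPolynomial ℤ →+* ℤ) (hev : ev (T 1) = -1)
    {P : (Matrix (Fin 2) (Fin 2) (LaurentPolynomial ℤ))ˣ}
    (hP : P ∈ Submonoid.closure {Au, Bu⁻¹}) :
    1 ≤ ev (P.val 0 0) ∧ 0 ≤ ev (P.val 0 1) ∧ 0 ≤ ev (P.val 1 0) ∧ 1 ≤ ev (P.val 1 1) ∧
      (P = 1 ∨ 1 ≤ ev (P.val 0 1) + ev (P.val 1 0)) := by
  have hev' : ev (T (-1)) = -1 := by
    have h : ev (T 1) * ev (T (-1)) = 1 := by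
      rw [← map_mul, ← T_add]
      simp
    rw [hev] at h
    linarith
  induction hP using Submonoid.closure_induction_left with
  | one => simp
  | mul_left a ha P hP ih =>
    obtain ⟨h00, h01, h10, h11, -⟩ := ih
    rcases ha with rfl | rfl
    · simp [Au, Amat, Matrix.mul_apply, Fin.sum_univ_two, hev]
      grind
    · simp [Bu, Bmat, Matrix.mul_apply, Fin.sum_univ_two, hev']
      grind

theorem val_Au_mul_Bu : (Au * Bu).val = !![0, -T 1; T 1, -T 1] := by
  simp [Au, Bu, Amat, Bmat]

theorem val_Au_mul_Bu_mul_Au : (Au * Bu * Au).val = !![0, -T 1; -T 2, 0] := by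
  rw [Units.val_mul, val_Au_mul_Bu]
  simp [Au, Amat, ← T_add]

theorem val_Au_mul_Bu_mul_Au_sq :
    ((Au * Bu * Au) ^ 2).val = (T 3 : LaurentPolynomial ℤ) • 1 := by
  rw [pow_two, Units.val_mul, val_Au_mul_Bu_mul_Au,
    Matrix.mul_fin_two, Matrix.smul_one_eq_diagonal, Matrix.diagonal_fin_two]
  simp only [mul_zero, zero_mul, neg_mul_neg, ← T_add, add_zero, zero_add]
  rfl

theorem Au_mul_Bu_mul_Au_sq_eq : (Au * Bu * Au) ^ 2 = (Au * Bu) ^ 3 := by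
  ext1
  rw [val_Au_mul_Bu_mul_Au_sq, pow_three, Units.val_mul, Units.val_mul (Au * Bu), val_Au_mul_Bu,
    Matrix.mul_fin_two, Matrix.mul_fin_two, Matrix.smul_one_eq_diagonal,
    Matrix.diagonal_fin_two]
  simp only [mul_zero, zero_mul, neg_mul, mul_neg, neg_neg, ← T_add, zero_add,
    add_zero, neg_zero, Int.reduceAdd, neg_add_cancel]

theorem val_Au_mul_Bu_mul_Au_sq_zpow (n : ℤ) :
    (((Au * Bu * Au) ^ 2) ^ n).val = (T (3 * n) : LaurentPolynomial ℤ) • 1 := by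
  have hz := val_Au_mul_Bu_mul_Au_sq
  generalize (Au * Bu * Au) ^ 2 = z at hz ⊢
  induction n with
  | zero => simp
  | succ n ih =>
    rw [_root_.zpow_add_one, Units.val_mul, ih, hz, smul_mul_smul_comm, ← T_add, mul_one, mul_add, mul_one]
  | pred n ih =>
    have h : (z ^ (-(n : ℤ) - 1)).val * z.val = (T (3 * (-(n : ℤ))) : LaurentPolynomial ℤ) • 1 := by
      rw [← ih, ← Units.val_mul, ← _root_.zpow_add_one, sub_add_cancel]
    rw [hz, mul_smul_comm, mul_one] at h
    have h' := congrArg ((T (-3) : LaurentPolynomial ℤ) • ·) h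
    simp only [smul_smul, ← T_add] at h'
    rw [show (-3 : ℤ) + 3 = 0 by norm_num, T_zero, one_smul] at h'
    rw [h']
    congr 2
    ring

/-- If a matrix M in the subgroup generated by the reduced Burau matrices A, B of
σ₁, σ₂ ∈ B₃ evaluates at t = −1 to the identity matrix, then M = t^{6k}·I₂ for some
integer k: the kernel of B₃ → SL(2,ℤ) corresponds to the cyclic group generated by
the Burau matrix t⁶·I₂ of Δ⁴. -/
theorem eval_eq_one_imp_scalar (M : (Matrix (Fin 2) (Fin 2) (LaurentPolynomial ℤ))ˣ)
    (hM : M ∈ Subgroup.closure {Au, Bu})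
    (ev : LaurentPolynomial ℤ →+* ℤ) (hev : ev (T 1) = -1)
    (h1 : (M : Matrix (Fin 2) (Fin 2) (LaurentPolynomial ℤ)).map ev = 1) :
    ∃ k : ℤ,
      (M : Matrix (Fin 2) (Fin 2) (LaurentPolynomial ℤ)) =
        (T (6 * k) : LaurentPolynomial ℤ) •
          (1 : Matrix (Fin 2) (Fin 2) (LaurentPolynomial ℤ)) := by
  obtain ⟨y, hy⟩ : ∃ y, y = Au * Bu := ⟨_, rfl⟩
  obtain ⟨x, hx⟩ : ∃ x, x = Au * Bu * Au := ⟨_, rfl⟩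
  have hxy : x ^ 2 = y ^ 3 := by
    rw [hx, hy, Au_mul_Bu_mul_Au_sq_eq]
  have hA : y⁻¹ * x = Au := by simp [hx, hy, mul_assoc]
  have hB : y⁻¹ * y⁻¹ * x = Bu⁻¹ := by simp [hx, hy, mul_assoc]
  have hgen : M ∈ Subgroup.closure {x, y} := by
    refine (Subgroup.closure_le _).2 ?_ hM
    have hxm : x ∈ Subgroup.closure {x, y} := Subgroup.subset_closure (by simp)
    have hym : y ∈ Subgroup.closure {x, y} := Subgroup.subset_closure (by simp)
    rintro _ (rfl | rfl)
    · exact hA ▸ mul_mem (inv_mem hym) hxm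
    · exact inv_mem_iff.1 (hB ▸ mul_mem (mul_mem (inv_mem hym) (inv_mem hym)) hxm)
  obtain ⟨m, j, P, hP, hMP⟩ := exists_eq_zpow_mul_mul_zpow hxy hgen
  rw [hA, hB] at hP
  obtain ⟨h00, h01, h10, h11, hP1⟩ := eval_entries_of_mem_closure ev hev hP
  have hm : x ^ m = (x ^ 2) ^ (m / 2) * x ^ (m % 2) := by
    rw [← zpow_natCast, ← _root_.zpow_mul, ← _root_.zpow_add]
    congr 1
    exact (Int.mul_ediv_add_emod m 2).symm
  have hj : y ^ j = y ^ (j % 3) * (x ^ 2) ^ (j / 3) := by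
    rw [hxy, ← zpow_natCast, ← _root_.zpow_mul, ← _root_.zpow_add]
    congr 1
    exact (Int.emod_add_mul_ediv j 3).symm
  have hz := val_Au_mul_Bu_mul_Au_sq_zpow
  rw [← hx] at hz
  set n := m / 2 + j / 3 with hn
  have hM' : M.val = (T (3 * n) : LaurentPolynomial ℤ) •
      ((x ^ (m % 2)).val * P.val * (y ^ (j % 3)).val) := by
    rw [hMP, hm, hj]
    simp only [Units.val_mul, hz, smul_mul_assoc, mul_smul_comm, one_mul, mul_one, smul_smul,
      ← T_add, mul_assoc]
    congr 2
    rw [hn]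
    ring
  have hev_add (k l : ℤ) : ev (T (k + l)) = ev (T k) * ev (T l) := by rw [T_add, map_mul]
  have hev2 : ev (T 2) = 1 := by
    rw [show (2 : ℤ) = 1 + 1 by norm_num, hev_add, hev]
    norm_num
  have hc : ev (T (3 * n)) = 1 ∨ ev (T (3 * n)) = -1 := by
    apply Int.isUnit_iff.1
    apply IsUnit.of_mul_eq_one (ev (T (-(3 * n))))
    rw [← hev_add]
    simp
  have hent (i k : Fin 2) : ev (M.val i k) = (1 : Matrix (Fin 2) (Fin 2) ℤ) i k := by
    rw [← h1, Matrix.map_apply]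
  have e00 := hent 0 0
  have e01 := hent 0 1
  have e10 := hent 1 0
  have e11 := hent 1 1
  rw [hM'] at e00 e01 e10 e11
  have hy2 : (y ^ 2).val = y.val * y.val := by rw [pow_two, Units.val_mul]
  have hxval : x.val = !![0, -T 1; -T 2, 0] := hx ▸ val_Au_mul_Bu_mul_Au
  have hyval : y.val = !![0, -T 1; T 1, -T 1] := hy ▸ val_Au_mul_Bu
  have hm2 : m % 2 = 0 ∨ m % 2 = 1 := Int.emod_two_eq_zero_or_one m
  have hj3 : j % 3 = 0 ∨ j % 3 = 1 ∨ j % 3 = 2 := by lia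
  have key : m % 2 = 0 ∧ j % 3 = 0 ∧ P = 1 ∧ ev (T (3 * n)) = 1 := by
    rcases hm2 with hm2 | hm2 <;> rcases hj3 with hj3 | hj3 | hj3 <;>
      rcases hc with hc | hc <;>
      simp [hm2, hj3, zpow_ofNat, hy2, hxval, hyval, Matrix.mul_apply, Fin.sum_univ_two,
        Matrix.vecMul, dotProduct, hev, hc] at e00 e01 e10 e11 ⊢ <;> grind
  obtain ⟨hm0, hj0, rfl, hc1⟩ := key
  obtain ⟨k, hk | hk⟩ := Int.even_or_odd' n
  · refine ⟨k, ?_⟩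
    rw [hM', hm0, hj0, hk]
    simp [← mul_assoc]
  · rw [show 3 * n = 3 * k + 3 * k + (2 + 1) by lia, hev_add, hev_add, hev_add, hev2, hev] at hc1
    nlinarith [mul_self_nonneg (ev (T (3 * k)))]
end
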